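/- Let (T,d,ρ,u) be a plane ℝ-tree and let p be a Borel probability measure on T. Then the set { p_↶(α) : α ∈ T×[0,1] } is dense in [0,1]. -/

import Mathlib

open Set MeasureTheory Filter Metric

/-- The metric segment `[[x,y]]` between `x` and `y`. -/
def geoSeg {T : Type*} [MetricSpace T] (x y : T) : Set T :=
  {z | dist x z + dist z y = dist x y}

/-- `(T,d)` is an `ℝ`-tree: it is geodesic (any two points are joined by a geodesic
segment, which is `geoSeg x y`) and loopless (this segment is the unique arc joining
`x` and `y`). -/
structure IsRTree (T : Type*) [MetricSpace T] : Prop where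
  geodesic : ∀ x y : T, ∃ γ : ℝ → T, γ 0 = x ∧ γ (dist x y) = y ∧
    (∀ s ∈ Icc (0:ℝ) (dist x y), ∀ t ∈ Icc (0:ℝ) (dist x y),
      dist (γ s) (γ t) = |s - t|) ∧
    γ '' Icc (0:ℝ) (dist x y) = geoSeg x y
  loopless : ∀ x y : T, ∀ f : ℝ → T, ContinuousOn f (Icc (0:ℝ) 1) →
    InjOn f (Icc (0:ℝ) 1) → f 0 = x → f 1 = y → f '' Icc (0:ℝ) 1 = geoSeg x y

/-- The set of connected components of `T \ {x}`. -/
def comps {T : Type*} [MetricSpace T] (x : T) : Set (Set T) :=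
  {C | ∃ y, y ≠ x ∧ C = connectedComponentIn ({x}ᶜ) y}

/-- A plane `ℝ`-tree structure on the metric space `T`: `T` is a separable complete
`ℝ`-tree with a root and a balanced angle function `u`.  `cca x y` is the closest
common ancestor of `x` and `y`. -/
structure PlaneRTree (T : Type*) [MetricSpace T] where
  sep : TopologicalSpace.SeparableSpace T
  cpl : CompleteSpace T
  tree : IsRTree T
  root : T
  cca : T → T → T
  cca_mem : ∀ x y : T, cca x y ∈ geoSeg root x ∩ geoSeg root y
  cca_max : ∀ x y : T, ∀ z ∈ geoSeg root x ∩ geoSeg root y,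
    dist root z ≤ dist root (cca x y)
  u : T → T → ℝ
  u_mem : ∀ x y : T, u x y ∈ Icc (0:ℝ) 1
  u_root : ∀ x : T, u x root = 0
  u_self : ∀ x : T, u x x = 0
  u_eq_iff : ∀ x y z : T, y ≠ x → z ≠ x →
    (u x y = u x z ↔ connectedComponentIn ({x}ᶜ) y = connectedComponentIn ({x}ᶜ) z)
  balanced : ∀ x y : T, (comps x).ncard = 2 → u x y = 0 ∨ u x y = 1/2

namespace PlaneRTree

variable {T : Type*} [MetricSpace T]

open Classical in
/-- The angle `u(x, (y,w))`: it is `u x y` if `x ≠ y`, and `w` if `x = y`. -/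
noncomputable def ang (P : PlaneRTree T) (x : T) (β : T × ℝ) : ℝ :=
  if x = β.1 then β.2 else P.u x β.1

/-- `α ↷ β` : `α` is at the left of `β`. -/
def leftOf (P : PlaneRTree T) (α β : T × ℝ) : Prop :=
  P.ang (P.cca α.1 β.1) α < P.ang (P.cca α.1 β.1) β

/-- `α → β` : `β` is in front of `α`. -/
def frontOf (P : PlaneRTree T) (α β : T × ℝ) : Prop :=
  α.1 ∈ geoSeg P.root β.1 ∧ P.ang α.1 β = α.2

/-- The contour relation `≺` : `α ≺ β` iff `α ↷ β` or `α → β`. -/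
def precOf (P : PlaneRTree T) (α β : T × ℝ) : Prop :=
  P.leftOf α β ∨ P.frontOf α β

end PlaneRTree

namespace PlaneRTree

variable {T : Type*} [MetricSpace T] [MeasurableSpace T] [BorelSpace T]

/-- The measure `p_L`, product of `p` with Lebesgue measure on `[0,1]`. -/
noncomputable def pL (p : Measure T) : Measure (T × ℝ) :=
  p.prod (volume.restrict (Icc (0:ℝ) 1))

/-- `p_↶(α) = p_L {β : β ↷ α}`, the mass at the left of `α`. -/
noncomputable def pleft (P : PlaneRTree T) (p : Measure T) (α : T × ℝ) : ℝ :=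
  (pL p {β : T × ℝ | P.leftOf β α}).toReal

/-- `p_→(α) = p_L {β : α → β}`, the mass in front of `α`. -/
noncomputable def pfront (P : PlaneRTree T) (p : Measure T) (α : T × ℝ) : ℝ :=
  (pL p {β : T × ℝ | P.frontOf α β}).toReal

/-- `p_↷(α) = p_L {β : α ↷ β}`, the mass at the right of `α`. -/
noncomputable def pright (P : PlaneRTree T) (p : Measure T) (α : T × ℝ) : ℝ :=
  (pL p {β : T × ℝ | P.leftOf α β}).toReal

end PlaneRTree

section OrderedMeasure

variable {X : Type*} [MeasurableSpace X] {μ : Measure X} [IsProbabilityMeasure μ] {R : X → X → Prop}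

lemma measurableSet_rel_right (hR : MeasurableSet {q : X × X | R q.1 q.2}) (a : X) :
    MeasurableSet {b | R a b} :=
  measurable_prodMk_left hR

lemma measurableSet_rel_left (hR : MeasurableSet {q : X × X | R q.1 q.2}) (a : X) :
    MeasurableSet {b | R b a} :=
  measurable_prodMk_right hR

/-- The points of a set that lie after a typical point of it fill at most half of the set. -/
lemma exists_measure_inter_rel_le_half (hR : MeasurableSet {q : X × X | R q.1 q.2})
    (hasymm : ∀ a b, R a b → ¬ R b a) {A : Set X} (hA : MeasurableSet A) (hA0 : μ A ≠ 0)
    {G : Set X} (hG : μ Gᶜ = 0) :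
    ∃ a ∈ A, a ∈ G ∧ μ (A ∩ {b | R a b}) ≤ μ A / 2 := by
  have hR' : MeasurableSet {q : X × X | R q.2 q.1} := measurable_swap hR
  set ν := μ.restrict A with hν
  have hν0 : ν ≠ 0 := by simpa [hν, Measure.restrict_eq_zero] using hA0
  have key : (ν.prod ν) {q : X × X | R q.1 q.2} ≤ ν univ * ν univ / 2 := by
    have hswap : (ν.prod ν) {q : X × X | R q.2 q.1} = (ν.prod ν) {q : X × X | R q.1 q.2} := by
      conv_rhs => rw [← Measure.prod_swap, Measure.map_apply measurable_swap hR]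
      rfl
    have hdisj : Disjoint {q : X × X | R q.1 q.2} {q : X × X | R q.2 q.1} :=
      Set.disjoint_left.2 fun q h h' => hasymm _ _ h h'
    have h := measure_union (μ := ν.prod ν) hdisj hR'
    rw [hswap, ← two_mul] at h
    rw [ENNReal.le_div_iff_mul_le (by simp) (by simp), mul_comm, ← h, ← Measure.prod_prod,
      univ_prod_univ]
    exact measure_mono (subset_univ _)
  rw [Measure.prod_apply hR] at key
  have hmeas : Measurable fun a => ν (Prod.mk a ⁻¹' {q : X × X | R q.1 q.2}) :=
    measurable_measure_prodMk_left hR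
  have hN : ν (Gᶜ ∪ Aᶜ) = 0 := by
    refine measure_union_null ?_ ?_
    · exact le_antisymm ((Measure.restrict_apply_le _ _).trans hG.le) zero_le
    · rw [hν, Measure.restrict_apply hA.compl]; simp
  obtain ⟨a, ha, hle⟩ := exists_notMem_null_le_laverage hν0 hmeas.aemeasurable hN
  simp only [mem_union, mem_compl_iff, not_or, not_not] at ha
  refine ⟨a, ha.2, ha.1, ?_⟩
  have hνu : ν univ = μ A := by simp [hν]
  have h1 : ν (Prod.mk a ⁻¹' {q : X × X | R q.1 q.2}) = μ (A ∩ {b | R a b}) := by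
    rw [hν, Measure.restrict_apply (measurable_prodMk_left hR), inter_comm]; rfl
  rw [← h1]
  refine hle.trans ?_
  rw [laverage_eq]
  refine (ENNReal.div_le_div_right key _).trans ?_
  rw [hνu]
  refine ENNReal.div_le_of_le_mul ?_
  rw [div_eq_mul_inv, div_eq_mul_inv]
  apply le_of_eq; ring

lemma exists_measure_inter_rel_le (hR : MeasurableSet {q : X × X | R q.1 q.2})
    (hasymm : ∀ a b, R a b → ¬ R b a) (htrans : ∀ a b c, R a b → R b c → R a c)
    {A : Set X} (hA : MeasurableSet A) (hA0 : μ A ≠ 0) {G : Set X} (hG : μ Gᶜ = 0) (n : ℕ) :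
    ∃ a ∈ A, a ∈ G ∧ μ (A ∩ {b | R a b}) ≤ 2⁻¹ ^ n := by
  induction n with
  | zero =>
    obtain ⟨a, h1, h2, -⟩ := exists_measure_inter_rel_le_half hR hasymm hA hA0 hG
    exact ⟨a, h1, h2, by simpa using prob_le_one⟩
  | succ n ih =>
    obtain ⟨a, haA, haG, ha⟩ := ih
    by_cases h0 : μ (A ∩ {b | R a b}) = 0
    · exact ⟨a, haA, haG, by simp [h0]⟩
    obtain ⟨b, hb, hbG, hle⟩ := exists_measure_inter_rel_le_half hR hasymm
      (hA.inter (measurableSet_rel_right hR a)) h0 hG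
    refine ⟨b, hb.1, hbG, ?_⟩
    calc μ (A ∩ {c | R b c}) ≤ μ (A ∩ {c | R a c} ∩ {c | R b c}) :=
          measure_mono fun c hc => ⟨⟨hc.1, htrans _ _ _ hb.2 hc.2⟩, hc.2⟩
      _ ≤ _ := hle
      _ ≤ 2⁻¹ ^ n / 2 := ENNReal.div_le_div_right ha _
      _ = _ := by rw [div_eq_mul_inv, pow_succ]

/-- If almost all points are comparable, a set whose typical points have initial segments of mass
at most `c` has mass at most `c`. -/
lemma measure_le_of_initial_le (hR : MeasurableSet {q : X × X | R q.1 q.2})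
    (hasymm : ∀ a b, R a b → ¬ R b a) (htrans : ∀ a b c, R a b → R b c → R a c)
    (htot : ∀ᵐ a ∂μ, μ {b | ¬ R a b ∧ ¬ R b a} = 0)
    {A : Set X} (hA : MeasurableSet A) {G : Set X} (hG : μ Gᶜ = 0) {c : ENNReal}
    (hc : ∀ a ∈ A, a ∈ G → μ {b | R b a} ≤ c) : μ A ≤ c := by
  by_cases hA0 : μ A = 0
  · simp [hA0]
  have hG' : μ (G ∩ {a | μ {b | ¬ R a b ∧ ¬ R b a} = 0})ᶜ = 0 := by
    rw [compl_inter]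
    exact measure_union_null hG htot
  have hn (n : ℕ) : μ A ≤ c + 2⁻¹ ^ n := by
    obtain ⟨a, haA, haG, ha⟩ := exists_measure_inter_rel_le hR hasymm htrans hA hA0 hG' n
    have hsub : A ⊆ ({b | R b a} ∪ (A ∩ {b | R a b})) ∪ {b | ¬ R a b ∧ ¬ R b a} := by
      intro b hb
      by_cases h1 : R a b <;> by_cases h2 : R b a <;> simp [h1, h2, hb]
    calc μ A ≤ _ := measure_mono hsub
      _ ≤ μ {b | R b a} + μ (A ∩ {b | R a b}) + μ {b | ¬ R a b ∧ ¬ R b a} :=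
        (measure_union_le _ _).trans (by gcongr; exact measure_union_le _ _)
      _ ≤ c + 2⁻¹ ^ n + 0 := by
        gcongr
        · exact hc a haA haG.1
        · exact le_of_eq haG.2
      _ = _ := add_zero _
  have hlim : Tendsto (fun n : ℕ => c + (2⁻¹ : ENNReal) ^ n) atTop (nhds (c + 0)) :=
    tendsto_const_nhds.add (ENNReal.tendsto_pow_atTop_nhds_zero_of_lt_one (by simp))
  rw [add_zero] at hlim
  exact ge_of_tendsto' hlim hn

/-- The masses of the initial segments of an almost everywhere total measurable strict order are
dense in `[0,1]`. -/
lemma mem_closure_initial_mass (hR : MeasurableSet {q : X × X | R q.1 q.2})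
    (hasymm : ∀ a b, R a b → ¬ R b a) (htrans : ∀ a b c, R a b → R b c → R a c)
    (htot : ∀ᵐ a ∂μ, μ {b | ¬ R a b ∧ ¬ R b a} = 0) {G : Set X} (hG : μ Gᶜ = 0)
    {r : ℝ} (hr : r ∈ Icc (0 : ℝ) 1) :
    r ∈ closure {s : ℝ | ∃ a ∈ G, (μ {b | R b a}).toReal = s} := by
  rw [Metric.mem_closure_iff]
  by_contra! hcon
  obtain ⟨ε, hε, hgap⟩ := hcon
  have hgap' (a : X) (ha : a ∈ G) : ε ≤ |r - (μ {b | R b a}).toReal| := by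
    simpa [Real.dist_eq] using hgap _ ⟨a, ha, rfl⟩
  have hF : Measurable fun a => (μ {b | R b a}).toReal :=
    (measurable_measure_prodMk_right hR).ennreal_toReal
  have hA : MeasurableSet {a | (μ {b | R b a}).toReal ≤ r} := measurableSet_le hF measurable_const
  have hle : μ {a | (μ {b | R b a}).toReal ≤ r} ≤ ENNReal.ofReal (r - ε) := by
    refine measure_le_of_initial_le hR hasymm htrans htot hA hG fun a ha haG => ?_
    rw [← ENNReal.ofReal_toReal (measure_ne_top μ {b | R b a})]
    refine ENNReal.ofReal_le_ofReal ?_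
    have := hgap' a haG
    rw [abs_of_nonneg (sub_nonneg.2 ha)] at this
    linarith
  have hle' : μ {a | (μ {b | R b a}).toReal ≤ r}ᶜ ≤ ENNReal.ofReal (1 - r - ε) := by
    refine measure_le_of_initial_le (R := fun a b => R b a) (measurable_swap hR)
      (fun a b h => hasymm _ _ h) (fun a b c h h' => htrans _ _ _ h' h)
      (htot.mono fun a ha => by simpa only [and_comm] using ha) hA.compl hG fun a ha haG => ?_
    rw [← ENNReal.ofReal_toReal (measure_ne_top μ {b | R a b})]
    refine ENNReal.ofReal_le_ofReal ?_
    have h1 := hgap' a haG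
    replace ha : r < (μ {b | R b a}).toReal := not_le.1 ha
    rw [abs_of_neg (sub_neg.2 ha)] at h1
    have hdisj : Disjoint {b | R a b} {b | R b a} :=
      Set.disjoint_left.2 fun b h h' => hasymm _ _ h h'
    have h2 : μ.real {b | R a b} + μ.real {b | R b a} ≤ 1 := by
      rw [← measureReal_union hdisj (measurableSet_rel_left hR a)]
      exact measureReal_le_one
    simp only [Measure.real] at h2
    linarith
  have hsum := measure_add_measure_compl (μ := μ) hA
  rw [measure_univ] at hsum
  have hlt : ENNReal.ofReal (r - ε) + ENNReal.ofReal (1 - r - ε) < 1 := by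
    have h1 : ENNReal.ofReal (r - ε) = ENNReal.ofReal (max (r - ε) 0) := by simp
    have h2 : ENNReal.ofReal (1 - r - ε) = ENNReal.ofReal (max (1 - r - ε) 0) := by simp
    rw [h1, h2, ← ENNReal.ofReal_add (le_max_right _ _) (le_max_right _ _),
      ENNReal.ofReal_lt_one]
    rcases max_cases (r - ε) 0 with h | h <;> rcases max_cases (1 - r - ε) 0 with h' | h' <;>
      linarith [hr.1, hr.2]
  exact absurd ((add_le_add hle hle').trans_lt hlt) (by rw [hsum]; exact lt_irrefl _)

end OrderedMeasure

section Geodesics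

variable {T : Type*} [MetricSpace T]

lemma left_mem_geoSeg (x y : T) : x ∈ geoSeg x y := by simp [geoSeg]

lemma right_mem_geoSeg (x y : T) : y ∈ geoSeg x y := by simp [geoSeg]

lemma geoSeg_trans {r x y z : T} (hxy : x ∈ geoSeg r y) (hyz : y ∈ geoSeg r z) :
    x ∈ geoSeg r z := by
  simp only [geoSeg, mem_ofPred_eq] at *
  linarith [dist_triangle x y z, dist_triangle r x z]

namespace IsRTree

variable (hT : IsRTree T)
include hT

lemma isPreconnected_geoSeg (x y : T) : IsPreconnected (geoSeg x y) := by
  obtain ⟨γ, -, -, hiso, himg⟩ := hT.geodesic x y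
  rw [← himg]
  refine isPreconnected_Icc.image γ ?_
  refine LipschitzOnWith.continuousOn (K := 1) (LipschitzOnWith.of_dist_le_mul fun s hs t ht => ?_)
  rw [hiso s hs t ht, NNReal.coe_one, one_mul, Real.dist_eq]

lemma dist_eq_abs_of_mem_geoSeg {r x y z : T} (hx : x ∈ geoSeg r z) (hy : y ∈ geoSeg r z) :
    dist x y = |dist r x - dist r y| := by
  obtain ⟨γ, h0, -, hiso, himg⟩ := hT.geodesic r z
  rw [← himg] at hx hy
  obtain ⟨s, hs, rfl⟩ := hx
  obtain ⟨t, ht, rfl⟩ := hy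
  have hz : (0 : ℝ) ∈ Icc 0 (dist r z) := ⟨le_rfl, dist_nonneg⟩
  have h (s) (hs : s ∈ Icc 0 (dist r z)) : dist r (γ s) = s := by
    conv_lhs => rw [← h0]
    rw [hiso 0 hz s hs, zero_sub, abs_neg, abs_of_nonneg hs.1]
  rw [h s hs, h t ht, hiso s hs t ht]

lemma mem_geoSeg_of_dist_le {r x y z : T} (hx : x ∈ geoSeg r z) (hy : y ∈ geoSeg r z)
    (h : dist r x ≤ dist r y) : x ∈ geoSeg r y := by
  have := hT.dist_eq_abs_of_mem_geoSeg hx hy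
  rw [abs_of_nonpos (by linarith)] at this
  simp only [geoSeg, mem_ofPred_eq]
  linarith

lemma eq_of_mem_geoSeg {r x y z : T} (hx : x ∈ geoSeg r z) (hy : y ∈ geoSeg r z)
    (h : dist r x = dist r y) : x = y := by
  have := hT.dist_eq_abs_of_mem_geoSeg hx hy
  rwa [h, sub_self, abs_zero, dist_eq_zero] at this

/-- Two geodesic segments issued from the same point `m` and meeting only there concatenate to a
geodesic segment. -/
lemma mem_geoSeg_of_inter_subset {x y m : T} (h : geoSeg m x ∩ geoSeg m y ⊆ {m}) :
    m ∈ geoSeg x y := by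
  obtain ⟨f, f0, f1, fiso, fimg⟩ := hT.geodesic m x
  obtain ⟨g, g0, g1, giso, gimg⟩ := hT.geodesic m y
  set a := dist m x with ha
  set b := dist m y with hb
  have ha0 : 0 ≤ a := dist_nonneg
  have hb0 : 0 ≤ b := dist_nonneg
  rcases (add_nonneg ha0 hb0).eq_or_lt with hab | hab
  · have : m = x := dist_eq_zero.1 (by linarith : dist m x = 0)
    exact this ▸ left_mem_geoSeg m y
  have hmaps {t : ℝ} (ht : t ∈ Icc (0 : ℝ) 1) : 0 ≤ t * (a + b) ∧ t * (a + b) ≤ a + b :=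
    ⟨mul_nonneg ht.1 hab.le, mul_le_of_le_one_left hab.le ht.2⟩
  set k : ℝ → T := fun s => if s ≤ a then f (a - s) else g (s - a) with hk
  have kf {s : ℝ} (hs : s ≤ a) : k s = f (a - s) := if_pos hs
  have kg {s : ℝ} (hs : a ≤ s) : k s = g (s - a) := by
    rcases hs.eq_or_lt with rfl | hs
    · rw [kf le_rfl, sub_self, f0, g0]
    · exact if_neg (not_le.2 hs)
  have kcont : ContinuousOn k (Icc 0 (a + b)) := by
    have hu : Icc 0 (a + b) = Icc 0 a ∪ Icc a (a + b) :=
      (Icc_union_Icc_eq_Icc ha0 (by linarith)).symm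
    have h1 : ContinuousOn k (Icc 0 a) := by
      refine LipschitzOnWith.continuousOn (K := 1)
        (LipschitzOnWith.of_dist_le_mul fun s hs t ht => ?_)
      rw [kf hs.2, kf ht.2, fiso _ ⟨by linarith [hs.2], by linarith [hs.1]⟩ _
        ⟨by linarith [ht.2], by linarith [ht.1]⟩, NNReal.coe_one, one_mul, Real.dist_eq,
        abs_sub_comm]
      apply le_of_eq; congr 1; ring
    have h2 : ContinuousOn k (Icc a (a + b)) := by
      refine LipschitzOnWith.continuousOn (K := 1)
        (LipschitzOnWith.of_dist_le_mul fun s hs t ht => ?_)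
      rw [kg hs.1, kg ht.1, giso _ ⟨by linarith [hs.1], by linarith [hs.2]⟩ _
        ⟨by linarith [ht.1], by linarith [ht.2]⟩, NNReal.coe_one, one_mul, Real.dist_eq]
      apply le_of_eq; congr 1; ring
    rw [hu]
    exact h1.union_of_isClosed h2 isClosed_Icc isClosed_Icc
  have kcross {s t : ℝ} (hs0 : 0 ≤ s) (hs : s ≤ a) (ht : a < t) (ht' : t ≤ a + b) : k s ≠ k t := by
    intro heq
    have h1 : k s ∈ geoSeg m x := by
      rw [← fimg, kf hs]; exact ⟨_, ⟨by linarith, by linarith⟩, rfl⟩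
    have h2 : k t ∈ geoSeg m y := by
      rw [← gimg, kg ht.le]; exact ⟨_, ⟨by linarith, by linarith⟩, rfl⟩
    have h3 : k t = m := h ⟨heq ▸ h1, h2⟩
    rw [kg ht.le] at h3
    have h4 := giso (t - a) ⟨by linarith, by linarith⟩ 0 ⟨le_rfl, hb0⟩
    rw [h3, g0, dist_self, sub_zero, abs_of_pos (by linarith)] at h4
    linarith
  have kinj : InjOn k (Icc 0 (a + b)) := by
    intro s hs t ht heq
    rcases le_or_gt s a with hsa | hsa <;> rcases le_or_gt t a with hta | hta
    · rw [kf hsa, kf hta] at heq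
      have h4 := fiso (a - s) ⟨by linarith, by linarith [hs.1]⟩ (a - t)
        ⟨by linarith, by linarith [ht.1]⟩
      rw [heq, dist_self] at h4
      linarith [abs_eq_zero.1 h4.symm]
    · exact absurd heq (kcross hs.1 hsa hta ht.2)
    · exact absurd heq.symm (kcross ht.1 hta hsa hs.2)
    · rw [kg hsa.le, kg hta.le] at heq
      have h4 := giso (s - a) ⟨by linarith, by linarith [hs.2]⟩ (t - a)
        ⟨by linarith, by linarith [ht.2]⟩
      rw [heq, dist_self] at h4
      linarith [abs_eq_zero.1 h4.symm]
  rw [← hT.loopless x y (fun t => k (t * (a + b)))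
    (kcont.comp (by fun_prop) fun t ht => hmaps ht)
    (fun s hs t ht heq => mul_right_cancel₀ hab.ne' (kinj (hmaps hs) (hmaps ht) heq))
    (by simp only [zero_mul]; rw [kf ha0, sub_zero, f1])
    (by simp only [one_mul]; rw [kg (by linarith), add_sub_cancel_left, g1])]
  refine ⟨a / (a + b), ⟨by positivity, (div_le_one hab).2 (by linarith)⟩, ?_⟩
  simp only [div_mul_cancel₀ _ hab.ne']
  rw [kf le_rfl, sub_self, f0]

end IsRTree

end Geodesics

namespace PlaneRTree

variable {T : Type*} [MetricSpace T] (P : PlaneRTree T)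

lemma le_cca {x y z : T} (hx : z ∈ geoSeg P.root x) (hy : z ∈ geoSeg P.root y) :
    z ∈ geoSeg P.root (P.cca x y) :=
  P.tree.mem_geoSeg_of_dist_le hx (P.cca_mem x y).1 (P.cca_max x y z ⟨hx, hy⟩)

lemma cca_comm (x y : T) : P.cca x y = P.cca y x := by
  have h := P.cca_mem x y
  have h' := P.cca_mem y x
  exact P.tree.eq_of_mem_geoSeg h.1 h'.2
    (le_antisymm (P.cca_max y x _ h.symm) (P.cca_max x y _ h'.symm))

lemma cca_mem_geoSeg (x y : T) : P.cca x y ∈ geoSeg x y := by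
  refine P.tree.mem_geoSeg_of_inter_subset fun z hz => ?_
  set m := P.cca x y with hm
  obtain ⟨h1, h2⟩ := P.cca_mem x y
  have key {w : T} (hw : m ∈ geoSeg P.root w) (hz : z ∈ geoSeg m w) :
      z ∈ geoSeg P.root w ∧ dist P.root z = dist P.root m + dist m z := by
    simp only [geoSeg, mem_ofPred_eq] at *
    have := dist_triangle P.root m z
    have := dist_triangle P.root z w
    constructor <;> linarith
  obtain ⟨hx, hd⟩ := key h1 hz.1
  have := P.cca_max x y z ⟨hx, (key h2 hz.2).1⟩
  exact (dist_le_zero.1 (by linarith : dist m z ≤ 0)).symm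

/-- The Gromov product formula for the height of the closest common ancestor. -/
lemma two_mul_dist_cca (x y : T) :
    2 * dist P.root (P.cca x y) = dist P.root x + dist P.root y - dist x y := by
  obtain ⟨h1, h2⟩ := P.cca_mem x y
  have h3 := P.cca_mem_geoSeg x y
  simp only [geoSeg, mem_ofPred_eq] at h1 h2 h3
  rw [dist_comm x (P.cca x y)] at h3
  linarith

lemma min_dist_cca_le (x y z : T) :
    min (dist P.root (P.cca x y)) (dist P.root (P.cca y z)) ≤ dist P.root (P.cca x z) := by
  obtain ⟨h1, h2⟩ := P.cca_mem x y
  obtain ⟨h3, h4⟩ := P.cca_mem y z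
  rcases le_total (dist P.root (P.cca x y)) (dist P.root (P.cca y z)) with h | h
  · exact (min_le_left _ _).trans
      (P.cca_max _ _ _ ⟨h1, geoSeg_trans (P.tree.mem_geoSeg_of_dist_le h2 h3 h) h4⟩)
  · exact (min_le_right _ _).trans
      (P.cca_max _ _ _ ⟨geoSeg_trans (P.tree.mem_geoSeg_of_dist_le h3 h2 h) h1, h4⟩)

lemma isOpen_lt_dist_cca (c : ℝ) (x : T) : IsOpen {z | c < dist P.root (P.cca x z)} := by
  have h : {z | c < dist P.root (P.cca x z)} =
      {z | 2 * c < dist P.root x + dist P.root z - dist x z} := by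
    ext z
    simp only [mem_ofPred_eq, ← P.two_mul_dist_cca]
    constructor <;> intro h <;> linarith
  rw [h]
  exact isOpen_lt (by fun_prop) (by fun_prop)

lemma dist_root_lt {x y : T} (h : x ∈ geoSeg P.root y) (hne : x ≠ y) :
    dist P.root x < dist P.root y := by
  have := dist_pos.2 hne
  simp only [geoSeg, mem_ofPred_eq] at h
  linarith

lemma eq_cca_of_le {x y m : T} (hx : m ∈ geoSeg P.root x) (hy : m ∈ geoSeg P.root y)
    (h : dist P.root (P.cca x y) ≤ dist P.root m) : m = P.cca x y :=
  P.tree.eq_of_mem_geoSeg hx (P.cca_mem x y).1 (le_antisymm (P.cca_max x y m ⟨hx, hy⟩) h)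

lemma cca_self (x : T) : P.cca x x = x :=
  (P.eq_cca_of_le (right_mem_geoSeg _ x) (right_mem_geoSeg _ x) (by
    have := (P.cca_mem x x).1
    simp only [geoSeg, mem_ofPred_eq] at this
    linarith [dist_nonneg (x := P.cca x x) (y := x)])).symm

/-- Points whose common ancestor lies strictly above `m` are in the same component of `T \ {m}`. -/
lemma comp_eq_of_lt {m m' x y : T} (h : dist P.root m < dist P.root m')
    (hx : m' ∈ geoSeg P.root x) (hy : m' ∈ geoSeg P.root y) :
    connectedComponentIn ({m}ᶜ) x = connectedComponentIn ({m}ᶜ) y := by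
  have key {w : T} (hw : m' ∈ geoSeg P.root w) :
      connectedComponentIn ({m}ᶜ) m' = connectedComponentIn ({m}ᶜ) w := by
    refine connectedComponentIn_eq ((P.tree.isPreconnected_geoSeg m' w).subset_connectedComponentIn
      (left_mem_geoSeg _ _) ?_ (right_mem_geoSeg _ _))
    rintro z hz rfl
    simp only [geoSeg, mem_ofPred_eq] at hw hz
    linarith [dist_triangle P.root z w, dist_nonneg (x := m') (y := z)]
  rw [← key hx, key hy]

lemma ne_of_dist_lt {m x y : T} (h : dist P.root m < dist P.root y) (hy : y ∈ geoSeg P.root x) :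
    x ≠ m := by
  rintro rfl
  simp only [geoSeg, mem_ofPred_eq] at hy
  linarith [dist_nonneg (x := y) (y := x)]

lemma ang_eq_of_lt {m m' : T} {α β : T × ℝ} (h : dist P.root m < dist P.root m')
    (hα : m' ∈ geoSeg P.root α.1) (hβ : m' ∈ geoSeg P.root β.1) : P.ang m α = P.ang m β := by
  have h1 := P.ne_of_dist_lt h hα
  have h2 := P.ne_of_dist_lt h hβ
  rw [ang, ang, if_neg h1.symm, if_neg h2.symm, P.u_eq_iff _ _ _ h1 h2]
  exact P.comp_eq_of_lt h hα hβ

/-- The component of `T \ {m}` of a point above `m` consists of points that share with it an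
ancestor strictly above `m`. -/
lemma lt_dist_cca_of_comp_eq {m x y : T} (hx : m ∈ geoSeg P.root x) (hxm : x ≠ m) (hym : y ≠ m)
    (h : connectedComponentIn ({m}ᶜ) x = connectedComponentIn ({m}ᶜ) y) :
    dist P.root m < dist P.root (P.cca x y) := by
  by_contra hcon
  have hpre := isPreconnected_connectedComponentIn (F := ({m}ᶜ : Set T)) (x := x)
  set U := {z | dist P.root m < dist P.root (P.cca x z)} with hU
  set V := {z | ¬ dist P.root m < dist P.root (P.cca x z) ∧ z ≠ m} with hV
  have hUo : IsOpen U := P.isOpen_lt_dist_cca _ _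
  have hVo : IsOpen V := by
    refine isOpen_iff_mem_nhds.2 fun z ⟨hz, hzm⟩ => ?_
    rw [not_lt] at hz
    rcases hz.eq_or_lt with hz | hz
    · have hmz : m ∈ geoSeg P.root z := by
        rw [← P.tree.eq_of_mem_geoSeg (P.cca_mem x z).1 hx hz]
        exact (P.cca_mem x z).2
      have hlt : dist P.root m < dist P.root (P.cca z z) := by
        rw [P.cca_self]; exact P.dist_root_lt hmz hzm.symm
      filter_upwards [(P.isOpen_lt_dist_cca (dist P.root m) z).mem_nhds hlt] with z' hz'
      constructor
      · intro h1
        have := P.min_dist_cca_le x z' z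
        rw [P.cca_comm z' z, hz] at this
        exact absurd this (not_le.2 (lt_min h1 hz'))
      · rintro rfl
        exact absurd hz' (not_lt.2 (by
          have := (P.cca_mem z z').2
          simp only [geoSeg, mem_ofPred_eq] at this
          linarith [dist_nonneg (x := P.cca z z') (y := z')]))
    · have h : IsOpen {z | dist P.root (P.cca x z) < dist P.root m} := by
        have h : {z | dist P.root (P.cca x z) < dist P.root m} =
            {z | dist P.root x + dist P.root z - dist x z < 2 * dist P.root m} := by
          ext z
          simp only [mem_ofPred_eq, ← P.two_mul_dist_cca]
          constructor <;> intro h <;> linarith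
        rw [h]
        exact isOpen_lt (by fun_prop) (by fun_prop)
      filter_upwards [h.mem_nhds hz, isOpen_ne.mem_nhds hzm] with z' h1 h2
      exact ⟨not_lt.2 (le_of_lt h1), h2⟩
  have hxC : x ∈ connectedComponentIn ({m}ᶜ) x := mem_connectedComponentIn hxm
  have hyC : y ∈ connectedComponentIn ({m}ᶜ) x := h ▸ mem_connectedComponentIn hym
  have hxU : x ∈ U := by
    show dist P.root m < dist P.root (P.cca x x)
    rw [P.cca_self]; exact P.dist_root_lt hx hxm.symm
  obtain ⟨z, -, hzU, hzV⟩ := hpre U V hUo hVo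
    (fun z hz => by
      by_cases h1 : z ∈ U
      · exact Or.inl h1
      · exact Or.inr ⟨h1, connectedComponentIn_subset _ _ hz⟩)
    ⟨x, hxC, hxU⟩ ⟨y, hyC, hcon, hym⟩
  exact hzV.1 hzU

lemma leftOf_iff {α β : T × ℝ} : P.leftOf α β ↔
    ∃ m, m ∈ geoSeg P.root α.1 ∧ m ∈ geoSeg P.root β.1 ∧ P.ang m α < P.ang m β := by
  refine ⟨fun h => ⟨_, (P.cca_mem _ _).1, (P.cca_mem _ _).2, h⟩, ?_⟩
  rintro ⟨m, hα, hβ, h⟩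
  rcases le_or_gt (dist P.root (P.cca α.1 β.1)) (dist P.root m) with hle | hlt
  · rwa [leftOf, ← P.eq_cca_of_le hα hβ hle]
  · exact absurd h (P.ang_eq_of_lt hlt (P.cca_mem _ _).1 (P.cca_mem _ _).2).not_lt

lemma leftOf_asymm (α β : T × ℝ) (h : P.leftOf α β) : ¬ P.leftOf β α := by
  rw [leftOf, P.cca_comm]
  exact not_lt.2 (le_of_lt h)

lemma leftOf_trans (α β γ : T × ℝ) (h : P.leftOf α β) (h' : P.leftOf β γ) : P.leftOf α γ := by
  obtain ⟨h1, h2⟩ := P.cca_mem α.1 β.1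
  obtain ⟨h3, h4⟩ := P.cca_mem β.1 γ.1
  rw [leftOf] at h h'
  rw [leftOf_iff]
  rcases lt_trichotomy (dist P.root (P.cca α.1 β.1)) (dist P.root (P.cca β.1 γ.1)) with hd | hd | hd
  · refine ⟨_, h1, geoSeg_trans (P.tree.mem_geoSeg_of_dist_le h2 h3 hd.le) h4, ?_⟩
    rwa [← P.ang_eq_of_lt hd h3 h4]
  · rw [← P.tree.eq_of_mem_geoSeg h2 h3 hd] at h4 h'
    exact ⟨_, h1, h4, h.trans h'⟩
  · refine ⟨_, geoSeg_trans (P.tree.mem_geoSeg_of_dist_le h3 h2 hd.le) h1, h4, ?_⟩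
    rwa [P.ang_eq_of_lt hd h1 h2]

/-- Of two points neither of which is at the left of the other, one is in front of the other. -/
lemma frontOf_or_frontOf_of_not_leftOf {α β : T × ℝ} (h : ¬ P.leftOf α β) (h' : ¬ P.leftOf β α) :
    P.frontOf α β ∨ P.frontOf β α := by
  set m := P.cca α.1 β.1 with hm
  obtain ⟨h1, h2⟩ := P.cca_mem α.1 β.1
  have heq : P.ang m α = P.ang m β := by
    rw [leftOf, P.cca_comm] at h'
    exact le_antisymm (not_lt.1 h') (not_lt.1 h)
  by_cases hα : m = α.1
  · left
    refine ⟨hα ▸ h2, ?_⟩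
    rw [← hα, ← heq, ang, if_pos hα]
  by_cases hβ : m = β.1
  · right
    refine ⟨hβ ▸ h1, ?_⟩
    rw [← hβ, heq, ang, if_pos hβ]
  rw [ang, ang, if_neg hα, if_neg hβ, P.u_eq_iff _ _ _ (Ne.symm hα) (Ne.symm hβ)] at heq
  exact absurd (P.lt_dist_cca_of_comp_eq h1 (Ne.symm hα) (Ne.symm hβ) heq) (lt_irrefl _)

end PlaneRTree

namespace PlaneRTree

variable {T : Type*} [MetricSpace T] (P : PlaneRTree T)

/-- Outside of a countable set of points the tree does not branch, so that all strict descendants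
of the point have angle `1/2`. -/
lemma exists_countable_u_eq_half : ∃ B : Set T, B.Countable ∧
    ∀ x ∉ B, ∀ y, x ∈ geoSeg P.root y → x ≠ y → P.u x y = 1 / 2 := by
  have := P.sep
  obtain ⟨D, hDc, hDd⟩ := TopologicalSpace.exists_countable_dense T
  refine ⟨insert P.root (image2 P.cca D D), (hDc.image2 hDc _).insert _, ?_⟩
  intro x hx y hxy hne
  simp only [mem_insert_iff, not_or] at hx
  obtain ⟨hroot, hx⟩ := hx
  have hself {z : T} (hz : x ∈ geoSeg P.root z) (hzx : x ≠ z) :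
      dist P.root x < dist P.root (P.cca z z) := by
    rw [P.cca_self]; exact P.dist_root_lt hz hzx
  have hbelow {z : T} (hz : x ∈ geoSeg P.root z) (hzx : x ≠ z) :
      dist P.root x < dist P.root (P.cca y z) := by
    by_contra hcon
    obtain ⟨d, hd, hdD⟩ := hDd.inter_open_nonempty _
      (P.isOpen_lt_dist_cca (dist P.root x) y) ⟨y, hself hxy hne⟩
    obtain ⟨e, he, heD⟩ := hDd.inter_open_nonempty _
      (P.isOpen_lt_dist_cca (dist P.root x) z) ⟨z, hself hz hzx⟩
    have hxd : x ∈ geoSeg P.root d := geoSeg_trans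
      (P.tree.mem_geoSeg_of_dist_le hxy (P.cca_mem y d).1 (le_of_lt hd)) (P.cca_mem y d).2
    have hxe : x ∈ geoSeg P.root e := geoSeg_trans
      (P.tree.mem_geoSeg_of_dist_le hz (P.cca_mem z e).1 (le_of_lt he)) (P.cca_mem z e).2
    refine hx ⟨d, hdD, e, heD, (P.eq_cca_of_le hxd hxe ?_).symm⟩
    by_contra hde
    rw [not_le] at hde
    have h1 := P.min_dist_cca_le y d e
    have h2 := P.min_dist_cca_le y e z
    rw [P.cca_comm e z] at h2
    exact hcon (((lt_min ((lt_min hd hde).trans_le h1) he)).trans_le h2)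
  have hsame {z : T} (hz : x ∈ geoSeg P.root z) (hzx : x ≠ z) :
      connectedComponentIn ({x}ᶜ) z = connectedComponentIn ({x}ᶜ) y :=
    P.comp_eq_of_lt (hbelow hz hzx) (P.cca_mem y z).2 (P.cca_mem y z).1
  have hother {z : T} (hz : x ∉ geoSeg P.root z) :
      connectedComponentIn ({x}ᶜ) z = connectedComponentIn ({x}ᶜ) P.root := by
    refine (connectedComponentIn_eq
      ((P.tree.isPreconnected_geoSeg P.root z).subset_connectedComponentIn
        (left_mem_geoSeg _ _) ?_ (right_mem_geoSeg _ _))).symm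
    rintro w hw rfl
    exact hz hw
  have hdiff : connectedComponentIn ({x}ᶜ) y ≠ connectedComponentIn ({x}ᶜ) P.root := by
    intro h
    have h1 := P.lt_dist_cca_of_comp_eq hxy hne.symm (Ne.symm hroot) h
    have h2 := (P.cca_mem y P.root).2
    simp only [geoSeg, mem_ofPred_eq, dist_self] at h2
    linarith [dist_nonneg (x := P.root) (y := x), dist_nonneg (x := P.cca y P.root) (y := P.root)]
  have hcomps : comps x = {connectedComponentIn ({x}ᶜ) y, connectedComponentIn ({x}ᶜ) P.root} := by
    ext C
    simp only [comps, mem_ofPred_eq, mem_insert_iff, mem_singleton_iff]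
    constructor
    · rintro ⟨z, hz, rfl⟩
      by_cases hxz : x ∈ geoSeg P.root z
      · exact Or.inl (hsame hxz hz.symm)
      · exact Or.inr (hother hxz)
    · rintro (rfl | rfl)
      · exact ⟨y, hne.symm, rfl⟩
      · exact ⟨P.root, Ne.symm hroot, rfl⟩
  refine (P.balanced x y (by rw [hcomps, ncard_pair hdiff])).resolve_left fun h => hdiff ?_
  rw [← P.u_eq_iff x y P.root hne.symm (Ne.symm hroot), h, P.u_root]

lemma continuousOn_u (b : T) : ContinuousOn (P.u b) {b}ᶜ := by
  intro z hz
  have hzb : z ≠ b := hz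
  refine ContinuousAt.continuousWithinAt ?_
  have heq : P.u b =ᶠ[nhds z] fun _ => P.u b z := by
    filter_upwards [ball_mem_nhds z (dist_pos.2 hzb)] with w hw
    have hsub : geoSeg z w ⊆ {b}ᶜ := by
      rintro y hy rfl
      simp only [geoSeg, mem_ofPred_eq] at hy
      rw [mem_ball, dist_comm] at hw
      linarith [dist_nonneg (x := y) (y := w)]
    rw [P.u_eq_iff b w z (hsub (right_mem_geoSeg z w)) hzb]
    exact (connectedComponentIn_eq
      ((P.tree.isPreconnected_geoSeg z w).subset_connectedComponentIn
        (left_mem_geoSeg _ _) hsub (right_mem_geoSeg _ _))).symm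
  exact continuousAt_const.congr heq.symm

variable [MeasurableSpace T] [BorelSpace T]

lemma measurable_ang (b : T) : Measurable (P.ang b) := by
  refine Measurable.ite ?_ measurable_snd
    ((measurable_of_continuousOn_compl_singleton b (P.continuousOn_u b)).comp measurable_fst)
  exact measurable_fst (measurableSet_eq (a := b)) |>.congr (by ext; simp [eq_comm])

lemma measurableSet_le_tree :
    MeasurableSet {q : (T × ℝ) × T × ℝ | q.1.1 ∈ geoSeg P.root q.2.1} := by
  have := P.sep
  have : SecondCountableTopology T := UniformSpace.secondCountable_of_separable T
  simp only [geoSeg, mem_ofPred_eq]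
  exact measurableSet_eq_fun (by fun_prop) (by fun_prop)

lemma measurableSet_leftOf : MeasurableSet {q : (T × ℝ) × T × ℝ | P.leftOf q.1 q.2} := by
  have := P.sep
  have : SecondCountableTopology T := UniformSpace.secondCountable_of_separable T
  obtain ⟨B, hB, hhalf⟩ := P.exists_countable_u_eq_half
  have hBm : MeasurableSet B := hB.measurableSet
  have hle := P.measurableSet_le_tree
  have hge : MeasurableSet {q : (T × ℝ) × T × ℝ | q.2.1 ∈ geoSeg P.root q.1.1} :=
    measurable_swap hle
  have heq : MeasurableSet {q : (T × ℝ) × T × ℝ | q.1.1 = q.2.1} :=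
    measurableSet_eq_fun (by fun_prop) (by fun_prop)
  have hset : {q : (T × ℝ) × T × ℝ | P.leftOf q.1 q.2} =
      (⋃ b ∈ B, {q : (T × ℝ) × T × ℝ | b ∈ geoSeg P.root q.1.1 ∧ b ∈ geoSeg P.root q.2.1 ∧
        P.ang b q.1 < P.ang b q.2}) ∪
      ({q | q.1.1 = q.2.1} ∩ {q | q.1.2 < q.2.2}) ∪
      ({q | q.1.1 ∈ geoSeg P.root q.2.1} ∩ {q | q.1.1 = q.2.1}ᶜ ∩ {q | q.1.1 ∈ B}ᶜ ∩
        {q | q.1.2 < 1 / 2}) ∪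
      ({q | q.2.1 ∈ geoSeg P.root q.1.1} ∩ {q | q.1.1 = q.2.1}ᶜ ∩ {q | q.2.1 ∈ B}ᶜ ∩
        {q | 1 / 2 < q.2.2}) := by
    ext ⟨⟨x, v⟩, ⟨y, w⟩⟩
    simp only [mem_union, mem_iUnion, mem_inter_iff, mem_compl_iff, mem_ofPred_eq, exists_prop]
    constructor
    · intro h
      obtain ⟨h1, h2⟩ := P.cca_mem x y
      have h' : P.ang (P.cca x y) (x, v) < P.ang (P.cca x y) (y, w) := h
      set m := P.cca x y with hm
      by_cases hmB : m ∈ B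
      · exact Or.inl (Or.inl (Or.inl ⟨m, hmB, h1, h2, h'⟩))
      simp only [ang] at h'
      by_cases hmx : m = x <;> by_cases hmy : m = y
      · rw [if_pos hmx, if_pos hmy] at h'
        exact Or.inl (Or.inl (Or.inr ⟨hmx ▸ hmy, h'⟩))
      · rw [if_pos hmx, if_neg hmy, hhalf m hmB y h2 hmy] at h'
        rw [hmx] at h2 hmy hmB
        exact Or.inl (Or.inr ⟨⟨⟨h2, hmy⟩, hmB⟩, h'⟩)
      · rw [if_neg hmx, if_pos hmy, hhalf m hmB x h1 hmx] at h'
        rw [hmy] at h1 hmx hmB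
        exact Or.inr ⟨⟨⟨h1, Ne.symm hmx⟩, hmB⟩, h'⟩
      · rw [if_neg hmx, if_neg hmy, hhalf m hmB x h1 hmx, hhalf m hmB y h2 hmy] at h'
        exact absurd h' (lt_irrefl _)
    · rw [leftOf_iff]
      rintro (((⟨b, -, h⟩ | ⟨rfl, h⟩) | ⟨⟨⟨h1, hne⟩, hB⟩, h⟩) | ⟨⟨⟨h1, hne⟩, hB⟩, h⟩)
      · exact ⟨b, h⟩
      · exact ⟨x, right_mem_geoSeg _ _, right_mem_geoSeg _ _, by simpa [ang] using h⟩
      · refine ⟨x, right_mem_geoSeg _ _, h1, ?_⟩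
        rwa [ang, ang, if_pos rfl, if_neg hne, hhalf x hB y h1 hne]
      · refine ⟨y, h1, right_mem_geoSeg _ _, ?_⟩
        rwa [ang, ang, if_pos rfl, if_neg (Ne.symm hne), hhalf y hB x h1 (Ne.symm hne)]
  rw [hset]
  refine (((MeasurableSet.biUnion hB fun b _ => ?_).union (heq.inter ?_)).union
    (((hle.inter heq.compl).inter ?_).inter ?_)).union
    (((hge.inter heq.compl).inter ?_).inter ?_)
  · have hb (f : (T × ℝ) × T × ℝ → T) (hf : Measurable f) :
        MeasurableSet {q | b ∈ geoSeg P.root (f q)} := by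
      simp only [geoSeg, mem_ofPred_eq]
      exact measurableSet_eq_fun (by fun_prop) (by fun_prop)
    exact (hb _ (by fun_prop)).inter ((hb _ (by fun_prop)).inter (measurableSet_lt
      ((P.measurable_ang b).comp measurable_fst) ((P.measurable_ang b).comp measurable_snd)))
  · exact measurableSet_lt (by fun_prop) (by fun_prop)
  · exact ((measurable_fst.comp measurable_fst) hBm).compl
  · exact measurableSet_lt (by fun_prop) (by fun_prop)
  · exact ((measurable_fst.comp measurable_snd) hBm).compl
  · exact measurableSet_lt (by fun_prop) (by fun_prop)

instance isProbabilityMeasure_pL (p : Measure T) [IsProbabilityMeasure p] :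
    IsProbabilityMeasure (pL p) := by
  have : IsProbabilityMeasure (volume.restrict (Icc (0 : ℝ) 1)) := ⟨by simp⟩
  unfold pL; infer_instance

lemma ae_measure_not_leftOf_eq_zero (p : Measure T) [IsProbabilityMeasure p] :
    ∀ᵐ α ∂pL p, pL p {β | ¬ P.leftOf α β ∧ ¬ P.leftOf β α} = 0 := by
  have hL := P.measurableSet_leftOf
  set N : Set ((T × ℝ) × T × ℝ) := {q | ¬ P.leftOf q.1 q.2 ∧ ¬ P.leftOf q.2 q.1} with hN
  have hNm : MeasurableSet N := hL.compl.inter (measurable_swap hL).compl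
  have hN1 : MeasurableSet (N ∩ {q | q.1.1 ∈ geoSeg P.root q.2.1}) :=
    hNm.inter P.measurableSet_le_tree
  set N' : Set ((T × ℝ) × T × ℝ) :=
    Prod.swap ⁻¹' (N ∩ {q | q.1.1 ∈ geoSeg P.root q.2.1}) with hN'
  have hN'm : MeasurableSet N' := measurable_swap hN1
  have hfront {α β : T × ℝ} (h : ¬ P.leftOf α β ∧ ¬ P.leftOf β α)
      (hle : α.1 ∈ geoSeg P.root β.1) : P.ang α.1 β = α.2 := by
    rcases P.frontOf_or_frontOf_of_not_leftOf h.1 h.2 with h | h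
    · exact h.2
    · have heq : α.1 = β.1 := P.tree.eq_of_mem_geoSeg hle (right_mem_geoSeg _ _) (by
        have h1 := h.1
        simp only [geoSeg, mem_ofPred_eq] at h1 hle
        linarith [dist_nonneg (x := α.1) (y := β.1), dist_nonneg (x := β.1) (y := α.1)])
      have h2 := h.2
      rw [ang, if_pos heq.symm] at h2
      rw [ang, if_pos heq, h2]
  have h1 : ((pL p).prod (pL p)) N' = 0 := by
    rw [Measure.measure_prod_null hN'm]
    refine Eventually.of_forall fun β => ?_
    have hsec : MeasurableSet (Prod.mk β ⁻¹' N') := measurable_prodMk_left hN'm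
    show pL p (Prod.mk β ⁻¹' N') = 0
    rw [pL, Measure.measure_prod_null hsec]
    refine Eventually.of_forall fun x => ?_
    refine measure_mono_null (t := {P.ang x β}) (fun v hv => ?_) (by simp)
    exact (hfront hv.1 hv.2).symm
  have h2 : ((pL p).prod (pL p)) (Prod.swap ⁻¹' N') = 0 := by
    rw [← Measure.map_apply measurable_swap hN'm, Measure.prod_swap, h1]
  have h3 : ((pL p).prod (pL p)) N = 0 := by
    refine measure_mono_null ?_ (measure_union_null h1 h2)
    rintro ⟨α, β⟩ h
    rcases P.frontOf_or_frontOf_of_not_leftOf h.1 h.2 with h' | h'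
    · exact Or.inr ⟨h, h'.1⟩
    · exact Or.inl ⟨⟨h.2, h.1⟩, h'.1⟩
  exact (Measure.measure_prod_null hNm).1 h3

end PlaneRTree

/-- The set `{p_↶(α) : α ∈ T × [0,1]}` is dense in `[0,1]`. -/
theorem pleft_range_dense {T : Type*} [MetricSpace T]
    [MeasurableSpace T] [BorelSpace T] (P : PlaneRTree T)
    (p : Measure T) [IsProbabilityMeasure p] :
    ∀ r ∈ Icc (0:ℝ) 1,
      r ∈ closure {s : ℝ | ∃ α : T × ℝ, α.2 ∈ Icc (0:ℝ) 1 ∧ P.pleft p α = s} := by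
  intro r hr
  refine mem_closure_initial_mass P.measurableSet_leftOf P.leftOf_asymm P.leftOf_trans
    (P.ae_measure_not_leftOf_eq_zero p) (G := {α : T × ℝ | α.2 ∈ Icc (0:ℝ) 1}) ?_ hr
  have hG : MeasurableSet {α : T × ℝ | α.2 ∈ Icc (0:ℝ) 1} := measurable_snd measurableSet_Icc
  rw [PlaneRTree.pL, Measure.measure_prod_null hG.compl]
  refine Eventually.of_forall fun x => ?_
  show volume.restrict (Icc (0:ℝ) 1) (Icc (0:ℝ) 1)ᶜ = 0
  simp [Measure.restrict_apply measurableSet_Icc.compl]
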